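/- Let L be a Boolean algebra. Define L ⋈ L := {(a,b) ∈ L × L | a ∧ b = ⊥} with monoid operation (p,q)·(r,s) := ((p ∧ ¬s) ∨ r, (q ∧ ¬r) ∨ s) and identity (⊥,⊥), and action a ⊕ (p,q) := (a ∨ p) ∧ ¬q. Then (L, L ⋈ L, ⊕) is a change action: the operation · is well-defined on L ⋈ L, associative with identity (⊥,⊥), and ⊕ is a monoid action. Moreover this change action is complete: for any a, b ∈ L there is a change δ with a ⊕ δ = b. -/

import Mathlib

/-- A change action: a base set `A`, a monoid of changes `Δ`, and a monoid action `act`. -/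
structure ChangeAction (A : Type*) (Δ : Type*) where
  mul : Δ → Δ → Δ
  one : Δ
  mul_assoc : ∀ x y z : Δ, mul (mul x y) z = mul x (mul y z)
  one_mul : ∀ x : Δ, mul one x = x
  mul_one : ∀ x : Δ, mul x one = x
  act : A → Δ → A
  act_one : ∀ a : A, act a one = a
  act_mul : ∀ (a : A) (x y : Δ), act a (mul x y) = act (act a x) y

/-- `f'` is a derivative of `f`: `f (a ⊕ δ) = f a ⊕ f' a δ`. -/
def IsDerivative {A ΔA B ΔB : Type*} (CA : ChangeAction A ΔA) (CB : ChangeAction B ΔB)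
    (f : A → B) (f' : A → ΔA → ΔB) : Prop :=
  ∀ (a : A) (δ : ΔA), f (CA.act a δ) = CB.act (f a) (f' a δ)

/-- `f` is differentiable: some derivative exists. -/
def CDifferentiable {A ΔA B ΔB : Type*} (CA : ChangeAction A ΔA) (CB : ChangeAction B ΔB)
    (f : A → B) : Prop :=
  ∃ f', IsDerivative CA CB f f'

theorem bt_disj {L : Type*} [BooleanAlgebra L] (p q r s : L) (h : p ⊓ q = ⊥) (h' : r ⊓ s = ⊥) :
    ((p ⊓ sᶜ) ⊔ r) ⊓ ((q ⊓ rᶜ) ⊔ s) = ⊥ := by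
  rw [← disjoint_iff] at *
  rw [disjoint_sup_left, disjoint_sup_right, disjoint_sup_right]
  refine ⟨⟨h.mono inf_le_left inf_le_left, ?_⟩, ?_, h'⟩
  · exact (disjoint_compl_left).mono_left inf_le_right
  · exact (disjoint_compl_right).mono_right inf_le_right

theorem bt_assoc {L : Type*} [BooleanAlgebra L] (p r s t u : L) :
    (((p ⊓ sᶜ) ⊔ r) ⊓ uᶜ) ⊔ t = (p ⊓ ((s ⊓ tᶜ) ⊔ u)ᶜ) ⊔ ((r ⊓ uᶜ) ⊔ t) := by
  rw [compl_sup, compl_inf, compl_compl, inf_sup_right, inf_sup_right, inf_sup_left]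
  apply le_antisymm
  · refine sup_le (sup_le ?_ ?_) ?_
    · rw [inf_assoc]; exact le_sup_of_le_left le_sup_left
    · exact le_sup_of_le_right le_sup_left
    · exact le_sup_of_le_right le_sup_right
  · refine sup_le (sup_le ?_ ?_) (sup_le ?_ ?_)
    · rw [← inf_assoc]; exact le_sup_of_le_left le_sup_left
    · exact le_sup_of_le_right (inf_le_right.trans inf_le_left)
    · exact le_sup_of_le_left le_sup_right
    · exact le_sup_right

theorem bt_act {L : Type*} [BooleanAlgebra L] (a p q r s : L) :
    (a ⊔ ((p ⊓ sᶜ) ⊔ r)) ⊓ ((q ⊓ rᶜ) ⊔ s)ᶜ = (((a ⊔ p) ⊓ qᶜ) ⊔ r) ⊓ sᶜ := by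
  have h : (a ⊔ ((p ⊓ sᶜ) ⊔ r)) ⊓ sᶜ = ((a ⊔ p) ⊔ r) ⊓ sᶜ := by
    simp only [inf_sup_right, inf_assoc, inf_idem, sup_assoc]
  rw [compl_sup, compl_inf, compl_compl, inf_left_comm, h, sup_inf_right (a ⊔ p) qᶜ r,
    ← inf_assoc, inf_comm (qᶜ ⊔ r)]

/-- For a Boolean algebra `L`, the disjoint pairs `L ⋈ L` with the given monoid
operation and action form a change action on `L`, and it is complete. -/
theorem bowtie_changeAction {L : Type*} [BooleanAlgebra L] :
    ∃ C : ChangeAction L {p : L × L // p.1 ⊓ p.2 = ⊥},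
      (C.one : L × L) = (⊥, ⊥) ∧
      (∀ x y : {p : L × L // p.1 ⊓ p.2 = ⊥},
        (C.mul x y : L × L) =
          ((x.1.1 ⊓ (y.1.2)ᶜ) ⊔ y.1.1, (x.1.2 ⊓ (y.1.1)ᶜ) ⊔ y.1.2)) ∧
      (∀ (a : L) (δ : {p : L × L // p.1 ⊓ p.2 = ⊥}),
        C.act a δ = (a ⊔ δ.1.1) ⊓ (δ.1.2)ᶜ) ∧
      (∀ a b : L, ∃ δ, C.act a δ = b) := by
  refine ⟨{
    mul := fun x y => ⟨((x.1.1 ⊓ (y.1.2)ᶜ) ⊔ y.1.1, (x.1.2 ⊓ (y.1.1)ᶜ) ⊔ y.1.2),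
      bt_disj _ _ _ _ x.2 y.2⟩
    one := ⟨(⊥, ⊥), by simp⟩
    mul_assoc := fun x y z => Subtype.ext (Prod.ext (bt_assoc _ _ _ _ _) (bt_assoc _ _ _ _ _))
    one_mul := fun x => Subtype.ext (Prod.ext (by simp) (by simp))
    mul_one := fun x => Subtype.ext (Prod.ext (by simp) (by simp))
    act := fun a δ => (a ⊔ δ.1.1) ⊓ (δ.1.2)ᶜ
    act_one := fun a => by simp
    act_mul := fun a x y => bt_act _ _ _ _ _ }, rfl, fun _ _ => rfl, fun _ _ => rfl, ?_⟩
  intro a b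
  refine ⟨⟨(b, bᶜ), by simp⟩, ?_⟩
  simp
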